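/- Let G be a finite group and let X be a G-module that is free as a ℤ-module. Then X is cohomologically equivalent to the zero module if and only if X is a projective ℤ[G]-module. -/

import Mathlib

/-!
This file sets up Tate cohomology of a finite group `G` (with coefficients in objects of
`Rep ℤ G`), realized concretely in each degree `n ∈ ℤ` as
`Ĥ^n(G, M) = Ĥ⁰(G, Hom_ℤ(J n, M))`, where `J n` is the standard `n`-th syzygy of the
trivial module `ℤ` (the `n`-th tensor power of the augmentation ideal `I_G` for `n ≥ 0`,
and of its `ℤ`-linear dual for `n < 0`), and `Ĥ⁰` denotes invariants modulo norms.
Cup products are induced by the canonical comparison maps `J (i+j) ⟶ J i ⊗ J j`.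
-/

open CategoryTheory MonoidalCategory TensorProduct

set_option linter.unusedSectionVars false
set_option maxHeartbeats 1000000

attribute [instance 0] AddCommGroup.toIntModule

namespace Enc

variable {k : Type} [CommRing k] {G : Type} [Group G] [Fintype G]

/-! ### Degree-zero Tate cohomology: invariants modulo norms -/

section Aux
variable {V V₂ : Type} [AddCommGroup V] [Module k V] [AddCommGroup V₂] [Module k V₂]

/-- The norm map `v ↦ ∑_{g ∈ G} g • v` of a representation. -/
noncomputable def rnorm (ρ : Representation k G V) : V →ₗ[k] V := ∑ g : G, ρ g

lemma rnorm_mem_invariants (ρ : Representation k G V) (v : V) :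
    rnorm ρ v ∈ ρ.invariants := by
  intro g
  show (ρ g) ((∑ h : G, ρ h) v) = _
  simp only [LinearMap.sum_apply, map_sum]
  rw [Fintype.sum_equiv (Equiv.mulLeft g) _ (fun h => ρ h v) (fun h => by
    rw [← Module.End.mul_apply, ← map_mul]; rfl)]
  simp [rnorm]

/-- The norm map, viewed as landing in the invariants. -/
noncomputable def rnormRes (ρ : Representation k G V) : V →ₗ[k] ρ.invariants :=
  (rnorm ρ).codRestrict ρ.invariants (rnorm_mem_invariants ρ)

/-- The image of the norm map, inside the invariants. -/
noncomputable def rnormIm (ρ : Representation k G V) : Submodule k ρ.invariants :=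
  LinearMap.range (rnormRes ρ)

/-- Degree-zero Tate cohomology of a representation: invariants modulo norms. -/
noncomputable def tate0 (ρ : Representation k G V) : Type :=
  ρ.invariants ⧸ rnormIm ρ

noncomputable instance (ρ : Representation k G V) : AddCommGroup (tate0 ρ) :=
  inferInstanceAs (AddCommGroup (ρ.invariants ⧸ rnormIm ρ))

noncomputable instance (ρ : Representation k G V) : Module k (tate0 ρ) :=
  inferInstanceAs (Module k (ρ.invariants ⧸ rnormIm ρ))

/-- The Tate class of an invariant vector. -/
noncomputable def tate0mk {ρ : Representation k G V} (v : V) (hv : v ∈ ρ.invariants) :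
    tate0 ρ := Submodule.Quotient.mk (⟨v, hv⟩ : ρ.invariants)

lemma invariants_comp {ρ : Representation k G V} {σ : Representation k G V₂}
    (f : V →ₗ[k] V₂) (hf : ∀ (g : G) (v : V), f (ρ g v) = σ g (f v)) :
    ∀ x ∈ ρ.invariants, f x ∈ σ.invariants := by
  intro x hx g
  rw [← hf g x, hx g]

/-- Functoriality of degree-zero Tate cohomology along equivariant maps. -/
noncomputable def tate0map {ρ : Representation k G V} {σ : Representation k G V₂}
    (f : V →ₗ[k] V₂) (hf : ∀ (g : G) (v : V), f (ρ g v) = σ g (f v)) :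
    tate0 ρ →ₗ[k] tate0 σ :=
  Submodule.mapQ (rnormIm ρ) (rnormIm σ) (f.restrict (invariants_comp f hf))
    (by
      rintro ⟨x, hx⟩ ⟨y, hy⟩
      refine ⟨f y, ?_⟩
      apply Subtype.ext
      have hy' := congrArg Subtype.val hy
      show rnorm σ (f y) = _
      simp only [LinearMap.restrict_apply]
      have : rnorm σ (f y) = f (rnorm ρ y) := by
        simp only [rnorm, LinearMap.sum_apply, map_sum]
        exact Finset.sum_congr rfl fun g _ => (hf g y).symm
      rw [this]
      exact congrArg f hy')

end Aux

/-- Degree-zero Tate cohomology `Ĥ⁰(G, W) = W^G / N_G W` of an object of `Rep k G`. -/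
noncomputable def H0T (W : Rep k G) : Type := tate0 W.ρ

noncomputable instance (W : Rep k G) : AddCommGroup (H0T W) :=
  inferInstanceAs (AddCommGroup (tate0 W.ρ))

noncomputable instance (W : Rep k G) : Module k (H0T W) :=
  inferInstanceAs (Module k (tate0 W.ρ))

/-- Functoriality of `Ĥ⁰` along morphisms of representations. -/
noncomputable def H0Tmap {W W' : Rep k G} (ψ : W ⟶ W') : H0T W →ₗ[k] H0T W' :=
  tate0map ψ.hom (fun g v => Rep.hom_comm_apply ψ g v)

/-! ### The augmentation ideal and the syzygy modules `J n` -/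

variable (G)

/-- The augmentation map `ℤ[G] → ℤ`. -/
noncomputable def aug : (G →₀ ℤ) →ₗ[ℤ] ℤ :=
  Finsupp.linearCombination ℤ (fun _ : G => (1 : ℤ))

/-- The permutation representation of `G` on `H →₀ k` given by a `G`-action on `H`
(the old meaning of `Representation.ofMulAction`, which now lives on `MonoidAlgebra k H`). -/
noncomputable def ofMulAction (k : Type*) [CommSemiring k] (G : Type*) [Monoid G] (H : Type*)
    [MulAction G H] : Representation k G (H →₀ k) where
  toFun g := Finsupp.lmapDomain k k (g • ·)
  map_one' := by ext; simp
  map_mul' x y := by ext; simp [mul_smul]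

lemma aug_comm (g : G) (x : G →₀ ℤ) :
    aug G (ofMulAction ℤ G G g x) = aug G x := by
  unfold aug
  simp [ofMulAction, Finsupp.linearCombination_apply]
  rw [Finsupp.sum_mapDomain_index] <;> simp

/-- The underlying `ℤ`-module of the augmentation ideal. -/
noncomputable abbrev IGcar : Type := LinearMap.ker (aug G)

/-- The representation of `G` on the augmentation ideal. -/
noncomputable def IGρ : Representation ℤ G (IGcar G) where
  toFun g := (ofMulAction ℤ G G g).restrict (p := LinearMap.ker (aug G))
    (q := LinearMap.ker (aug G)) (by
      intro x hx
      simp only [LinearMap.mem_ker] at hx ⊢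
      rw [aug_comm]; exact hx)
  map_one' := by ext x; simp [LinearMap.restrict_apply]
  map_mul' g h := by ext x; simp [LinearMap.restrict_apply, Module.End.mul_apply]

/-- The augmentation ideal `I_G` of `ℤ[G]`, as an object of `Rep ℤ G`. -/
noncomputable def IGrep : Rep ℤ G := Rep.of (IGρ G)

/-- `Hom_ℤ(X, A)` with the conjugation `G`-action, i.e. the internal hom in `Rep ℤ G`. -/
noncomputable abbrev hRep {G : Type} [Group G] (X A : Rep.{0} ℤ G) : Rep.{0} ℤ G :=
  (Rep.ihom X).obj A

/-- The `ℤ`-linear dual of the augmentation ideal, as an object of `Rep ℤ G`. -/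
noncomputable def DIG : Rep ℤ G := hRep (IGrep G) (𝟙_ (Rep ℤ G))

instance : Module.Finite ℤ (IGcar G) := by
  have : Module.Finite ℤ (G →₀ ℤ) :=
    Module.Finite.equiv (Finsupp.linearEquivFunOnFinite ℤ ℤ G).symm
  exact Module.Finite.of_injective (LinearMap.ker (aug G)).subtype Subtype.val_injective

instance : Module.Free ℤ (IGcar G) := by infer_instance

/-- Nonnegative tensor powers `I_G^{⊗ n}` (with `I_G^{⊗ 0} = ℤ`). -/
noncomputable def Jp : ℕ → Rep ℤ G
  | 0 => 𝟙_ (Rep ℤ G)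
  | n + 1 => Jp n ⊗ IGrep G

/-- Tensor powers of the dual of the augmentation ideal. -/
noncomputable def Jn : ℕ → Rep ℤ G
  | 0 => 𝟙_ (Rep ℤ G)
  | n + 1 => Jn n ⊗ DIG G

/-- The standard syzygy modules of the trivial representation `ℤ`, indexed by `ℤ`:
`J n = I_G^{⊗ n}` for `n ≥ 0`, and `J n = (I_G^∨)^{⊗ (-n)}` for `n < 0`. -/
noncomputable def J : ℤ → Rep ℤ G
  | .ofNat n => Jp G n
  | .negSucc n => Jn G (n + 1)

lemma J_ofNat (m : ℕ) : J G (m : ℤ) = Jp G m := rfl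

lemma J_neg (m : ℕ) : J G (-(m : ℤ)) = Jn G m := by cases m <;> rfl

/-- The element of `(I_G)^∨ ⊗ I_G` corresponding to the identity map. -/
noncomputable def preElt : Module.Dual ℤ (IGcar G) ⊗[ℤ] IGcar G :=
  (dualTensorHomEquiv ℤ (IGcar G) (IGcar G)).symm LinearMap.id

/-- The canonical element of `I_G ⊗ (I_G)^∨` corresponding to the identity map. -/
noncomputable def coevElt : (IGrep G ⊗ DIG G).V :=
  (TensorProduct.comm ℤ _ _) (preElt G)

lemma conj_dualTensor (g : G) (t : Module.Dual ℤ (IGcar G) ⊗[ℤ] IGcar G) :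
    dualTensorHom ℤ _ _ (TensorProduct.map ((DIG G).ρ g) ((IGrep G).ρ g) t)
      = (IGrep G).ρ g ∘ₗ (dualTensorHom ℤ _ _ t) ∘ₗ (IGrep G).ρ g⁻¹ := by
  exact LinearMap.congr_fun (Representation.dualTensorHom_comm (IGρ G) (IGρ G) g) t

lemma coevElt_invariant (g : G) :
    ((IGrep G ⊗ DIG G).ρ g) (coevElt G) = coevElt G := by
  show TensorProduct.map ((IGrep G).ρ g) ((DIG G).ρ g)
      ((TensorProduct.comm ℤ _ _) (preElt G)) = _
  refine (TensorProduct.map_comm _ _ _).trans ?_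
  show (TensorProduct.comm ℤ _ _) (TensorProduct.map ((DIG G).ρ g) ((IGrep G).ρ g) (preElt G))
      = (TensorProduct.comm ℤ _ _) (preElt G)
  congr 1
  apply (dualTensorHomEquiv ℤ (IGcar G) (IGcar G)).injective
  have h2 : dualTensorHom ℤ (IGcar G) (IGcar G) (preElt G) = LinearMap.id :=
    (dualTensorHomEquiv ℤ (IGcar G) (IGcar G)).apply_symm_apply LinearMap.id
  show dualTensorHom ℤ (IGcar G) (IGcar G)
      (TensorProduct.map ((DIG G).ρ g) ((IGrep G).ρ g) (preElt G))
    = dualTensorHom ℤ (IGcar G) (IGcar G) (preElt G)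
  refine (conj_dualTensor G g (preElt G)).trans ?_
  show (IGrep G).ρ g ∘ₗ dualTensorHom ℤ (IGcar G) (IGcar G) (preElt G) ∘ₗ (IGrep G).ρ g⁻¹
      = dualTensorHom ℤ (IGcar G) (IGcar G) (preElt G)
  rw [h2]
  apply LinearMap.ext
  intro v
  exact Representation.self_inv_apply (IGrep G).ρ g v

/-- The coevaluation `ℤ ⟶ I_G ⊗ I_G^∨`. -/
noncomputable def coev : 𝟙_ (Rep ℤ G) ⟶ IGrep G ⊗ DIG G :=
  Rep.ofHom (ρ := (𝟙_ (Rep ℤ G)).ρ) (σ := (IGrep G ⊗ DIG G).ρ) {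
  toLinearMap := LinearMap.toSpanSingleton ℤ _ (coevElt G)
  isIntertwining' := by
    intro g
    apply LinearMap.ext
    intro z
    show LinearMap.toSpanSingleton ℤ _ (coevElt G) ((𝟙_ (Rep ℤ G)).ρ g z)
        = ((IGrep G ⊗ DIG G).ρ g) (LinearMap.toSpanSingleton ℤ _ (coevElt G) z)
    have hz : ((𝟙_ (Rep ℤ G)).ρ g z) = z := rfl
    rw [hz]
    show z • coevElt G = ((IGrep G ⊗ DIG G).ρ g) (z • coevElt G)
    rw [map_smul, coevElt_invariant] }


variable {G}

/-- One-step comparison `J (n+1) ⟶ J n ⊗ I_G`. -/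
noncomputable def sMap : ∀ n : ℤ, J G (n + 1) ⟶ J G n ⊗ IGrep G
  | .ofNat m => 𝟙 (Jp G m ⊗ IGrep G)
  | .negSucc 0 =>
      coev G ≫ (β_ (IGrep G) (DIG G)).hom ≫ ((λ_ (DIG G)).inv ▷ IGrep G)
  | .negSucc (m+1) =>
      (ρ_ (Jn G (m+1))).inv ≫ (Jn G (m+1) ◁ (coev G ≫ (β_ (IGrep G) (DIG G)).hom))
        ≫ (α_ (Jn G (m+1)) (DIG G) (IGrep G)).inv

/-- One-step comparison `J (n-1) ⟶ J n ⊗ I_G^∨`. -/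
noncomputable def tMap : ∀ n : ℤ, J G (n - 1) ⟶ J G n ⊗ DIG G
  | .ofNat 0 => 𝟙 (𝟙_ (Rep ℤ G) ⊗ DIG G)
  | .ofNat (m+1) =>
      eqToHom (congrArg (J G) (show (Int.ofNat (m+1)) - 1 = ((m:ℕ) : ℤ) by
        rw [Int.ofNat_eq_coe]; push_cast; ring)) ≫
      (ρ_ (Jp G m)).inv ≫ (Jp G m ◁ coev G) ≫ (α_ (Jp G m) (IGrep G) (DIG G)).inv
  | .negSucc m => eqToHom (show J G (Int.negSucc m - 1) = J G (Int.negSucc m) ⊗ DIG G from rfl)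

/-- Comparison maps `J (i + m) ⟶ J i ⊗ J m` for `m ≥ 0`. -/
noncomputable def μpos (i : ℤ) : ∀ m : ℕ, J G (i + m) ⟶ J G i ⊗ J G (m : ℤ)
  | 0 => eqToHom (congrArg (J G) (by omega)) ≫ (ρ_ (J G i)).inv
  | m + 1 =>
      eqToHom (congrArg (J G) (show i + ((m:ℕ)+1:ℕ) = (i + m) + 1 by omega))
        ≫ sMap (i + m) ≫ (μpos i m ▷ IGrep G) ≫ (α_ (J G i) (J G (m:ℤ)) (IGrep G)).hom

/-- Comparison maps `J (i - m) ⟶ J i ⊗ J (-m)` for `m ≥ 0`. -/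
noncomputable def μneg (i : ℤ) : ∀ m : ℕ, J G (i - m) ⟶ J G i ⊗ J G (-(m : ℤ))
  | 0 => eqToHom (congrArg (J G) (by omega)) ≫ (ρ_ (J G i)).inv
  | m + 1 =>
      eqToHom (congrArg (J G) (show i - ((m:ℕ)+1:ℕ) = (i - m) - 1 by omega))
        ≫ tMap (i - m) ≫ (μneg i m ▷ DIG G) ≫ (α_ (J G i) (J G (-(m:ℤ))) (DIG G)).hom
        ≫ (J G i ◁ (eqToHom (show J G (-(m:ℤ)) ⊗ DIG G = J G (-((m:ℕ)+1:ℕ)) by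
            rw [J_neg, J_neg]; rfl)))

variable (G)

/-- The canonical comparison map `J (i+j) ⟶ J i ⊗ J j`, implementing the standard stable
equivalences between the syzygies `J`; it induces the cup product on Tate cohomology. -/
noncomputable def μ (i : ℤ) : ∀ j : ℤ, J G (i + j) ⟶ J G i ⊗ J G j
  | .ofNat m => μpos i m
  | .negSucc m =>
      eqToHom (congrArg (J G) (show i + Int.negSucc m = i - ((m+1 : ℕ) : ℤ) by
        rw [Int.negSucc_eq]; push_cast; ring))
        ≫ μneg i (m+1)

variable {G}

/-! ### Tate cohomology in all degrees, functoriality, cup products -/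

/-- Tate cohomology `Ĥ^n(G, M)` of the finite group `G` with coefficients in `M : Rep ℤ G`,
realized as `Ĥ⁰(G, Hom_ℤ(J n, M))` for the standard `n`-th syzygy `J n` of `ℤ`. -/
noncomputable def tate (n : ℤ) (M : Rep ℤ G) : Type := H0T (hRep (J G n) M)

noncomputable instance (n : ℤ) (M : Rep ℤ G) : AddCommGroup (tate n M) :=
  inferInstanceAs (AddCommGroup (H0T (hRep (J G n) M)))

/-- The map on Tate cohomology induced by a morphism of representations. -/
noncomputable def tmap (n : ℤ) {M N : Rep ℤ G} (φ : M ⟶ N) : tate n M → tate n N :=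
  H0Tmap ((Rep.ihom (J G n)).map φ)

/-- Transport of Tate cohomology along an equality of degrees. -/
noncomputable def tcast {i j : ℤ} {M : Rep ℤ G} (h : i = j) (z : tate i M) : tate j M :=
  h ▸ z

lemma hom_invariant {X W : Rep.{0} ℤ G} (m : X ⟶ W) :
    m.hom.toLinearMap ∈ (hRep X W).ρ.invariants := by
  intro g
  show W.ρ g ∘ₗ m.hom.toLinearMap ∘ₗ X.ρ g⁻¹ = m.hom.toLinearMap
  ext v
  simp only [LinearMap.comp_apply]
  exact (congrArg (W.ρ g) (Rep.hom_comm_apply m g⁻¹ v)).trans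
    (Representation.self_inv_apply W.ρ g _)

/-- The Tate cohomology class of a `G`-equivariant map `J n ⟶ W`. -/
noncomputable def mkCls {n : ℤ} {W : Rep ℤ G} (m : J G n ⟶ W) : tate n W :=
  tate0mk m.hom.toLinearMap (hom_invariant m)


lemma tensor_rho_eq (M N : Rep ℤ G) (g : G) :
    (M ⊗ N).ρ g = TensorProduct.map (M.ρ g) (N.ρ g) := rfl

lemma map_comp_sum_left {V₁ V₂ V₃ V₄ V₅ : Type} [AddCommGroup V₁] [Module k V₁]
    [AddCommGroup V₂] [Module k V₂] [AddCommGroup V₃] [Module k V₃] [AddCommGroup V₄] [Module k V₄]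
    [AddCommGroup V₅] [Module k V₅] (f : G → V₁ →ₗ[k] V₂) (g : V₃ →ₗ[k] V₄)
    (m : V₅ →ₗ[k] V₁ ⊗[k] V₃) :
    (TensorProduct.map (∑ h : G, f h) g).comp m = ∑ h : G, (TensorProduct.map (f h) g).comp m := by
  rw [show TensorProduct.map (∑ h : G, f h) g = ∑ h : G, TensorProduct.map (f h) g from
    map_sum ((TensorProduct.mapBilinear (RingHom.id k) _ _ _ _).flip g) _ _]
  exact LinearMap.ext fun x => by simp [LinearMap.sum_apply]

lemma map_comp_sum_right {V₁ V₂ V₃ V₄ V₅ : Type} [AddCommGroup V₁] [Module k V₁]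
    [AddCommGroup V₂] [Module k V₂] [AddCommGroup V₃] [Module k V₃] [AddCommGroup V₄] [Module k V₄]
    [AddCommGroup V₅] [Module k V₅] (f : V₁ →ₗ[k] V₂) (g : G → V₃ →ₗ[k] V₄)
    (m : V₅ →ₗ[k] V₁ ⊗[k] V₃) :
    (TensorProduct.map f (∑ h : G, g h)).comp m = ∑ h : G, (TensorProduct.map f (g h)).comp m := by
  rw [show TensorProduct.map f (∑ h : G, g h) = ∑ h : G, TensorProduct.map f (g h) from
    map_sum (TensorProduct.mapBilinear (RingHom.id k) _ _ _ _ f) _ _]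
  exact LinearMap.ext fun x => by simp [LinearMap.sum_apply]

lemma map_comp_sub_left {V₁ V₂ V₃ V₄ V₅ : Type} [AddCommGroup V₁] [Module k V₁]
    [AddCommGroup V₂] [Module k V₂] [AddCommGroup V₃] [Module k V₃] [AddCommGroup V₄] [Module k V₄]
    [AddCommGroup V₅] [Module k V₅] (f f' : V₁ →ₗ[k] V₂) (g : V₃ →ₗ[k] V₄)
    (m : V₅ →ₗ[k] V₁ ⊗[k] V₃) :
    (TensorProduct.map (f - f') g).comp m
      = (TensorProduct.map f g).comp m - (TensorProduct.map f' g).comp m := by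
  rw [show TensorProduct.map (f - f') g = TensorProduct.map f g - TensorProduct.map f' g from
    map_sub ((TensorProduct.mapBilinear (RingHom.id k) _ _ _ _).flip g) _ _]
  exact LinearMap.ext fun x => by simp [LinearMap.sub_apply]

lemma map_comp_sub_right {V₁ V₂ V₃ V₄ V₅ : Type} [AddCommGroup V₁] [Module k V₁]
    [AddCommGroup V₂] [Module k V₂] [AddCommGroup V₃] [Module k V₃] [AddCommGroup V₄] [Module k V₄]
    [AddCommGroup V₅] [Module k V₅] (f : V₁ →ₗ[k] V₂) (g g' : V₃ →ₗ[k] V₄)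
    (m : V₅ →ₗ[k] V₁ ⊗[k] V₃) :
    (TensorProduct.map f (g - g')).comp m
      = (TensorProduct.map f g).comp m - (TensorProduct.map f g').comp m := by
  rw [show TensorProduct.map f (g - g') = TensorProduct.map f g - TensorProduct.map f g' from
    map_sub (TensorProduct.mapBilinear (RingHom.id k) _ _ _ _ f) _ _]
  exact LinearMap.ext fun x => by simp [LinearMap.sub_apply]

lemma cup_invariance {i j : ℤ} {M N : Rep ℤ G}
    (f : ((hRep (J G i) M).ρ.invariants))
    (g : ((hRep (J G j) N).ρ.invariants)) :
    (TensorProduct.map f.1 g.1).comp ((μ G i j).hom.toLinearMap)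
      ∈ (hRep (J G (i + j)) (M ⊗ N)).ρ.invariants := by
  intro gg
  have hf : M.ρ gg ∘ₗ f.1 ∘ₗ (J G i).ρ gg⁻¹ = f.1 := f.2 gg
  have hg : N.ρ gg ∘ₗ g.1 ∘ₗ (J G j).ρ gg⁻¹ = g.1 := g.2 gg
  have hμ : (μ G i j).hom.toLinearMap.comp ((J G (i + j)).ρ gg⁻¹)
      = (TensorProduct.map ((J G i).ρ gg⁻¹) ((J G j).ρ gg⁻¹)).comp (μ G i j).hom.toLinearMap := by
    have h := (μ G i j).hom.isIntertwining' gg⁻¹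
    exact h
  have aux : ∀ (u : (J G i).V →ₗ[ℤ] M.V) (w : (J G j).V →ₗ[ℤ] N.V),
      M.ρ gg ∘ₗ u ∘ₗ (J G i).ρ gg⁻¹ = u → N.ρ gg ∘ₗ w ∘ₗ (J G j).ρ gg⁻¹ = w →
      (M ⊗ N).ρ gg ∘ₗ ((TensorProduct.map u w).comp (μ G i j).hom.toLinearMap) ∘ₗ (J G (i + j)).ρ gg⁻¹
        = (TensorProduct.map u w).comp (μ G i j).hom.toLinearMap := by
    intro u w hf hg
    rw [LinearMap.comp_assoc, hμ, tensor_rho_eq, ← LinearMap.comp_assoc,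
      ← LinearMap.comp_assoc, ← TensorProduct.map_comp, ← TensorProduct.map_comp]
    rw [LinearMap.comp_assoc (((J G i)).ρ gg⁻¹) u (M.ρ gg),
      LinearMap.comp_assoc (((J G j)).ρ gg⁻¹) w (N.ρ gg), hf, hg]
  exact aux f.1 g.1 hf hg

lemma conj_term {i j : ℤ} {M N : Rep ℤ G} (u : (J G i).V →ₗ[ℤ] M.V)
    (w : (J G j).V →ₗ[ℤ] N.V) (h : G) :
    (TensorProduct.map (M.ρ h ∘ₗ u ∘ₗ (J G i).ρ h⁻¹) (N.ρ h ∘ₗ w ∘ₗ (J G j).ρ h⁻¹)).comp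
        (μ G i j).hom.toLinearMap
      = ((hRep (J G (i + j)) (M ⊗ N)).ρ h) ((TensorProduct.map u w).comp (μ G i j).hom.toLinearMap) := by
  have hμ : (μ G i j).hom.toLinearMap ∘ₗ (J G (i + j)).ρ h⁻¹
      = TensorProduct.map ((J G i).ρ h⁻¹) ((J G j).ρ h⁻¹) ∘ₗ (μ G i j).hom.toLinearMap := by
    have hc := (μ G i j).hom.isIntertwining' h⁻¹
    exact hc
  show _ = (M ⊗ N).ρ h ∘ₗ ((TensorProduct.map u w).comp (μ G i j).hom.toLinearMap) ∘ₗ (J G (i + j)).ρ h⁻¹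
  rw [LinearMap.comp_assoc, hμ, ← LinearMap.comp_assoc, ← LinearMap.comp_assoc]
  rw [TensorProduct.map_comp, TensorProduct.map_comp]
  rfl

lemma cup_norm_left {i j : ℤ} {M N : Rep ℤ G} (u : (J G i).V →ₗ[ℤ] M.V)
    (g : ((hRep (J G j) N).ρ.invariants)) :
    (TensorProduct.map (rnorm ((hRep (J G i) M).ρ) u) g.1).comp (μ G i j).hom.toLinearMap
      = rnorm ((hRep (J G (i + j)) (M ⊗ N)).ρ)
          ((TensorProduct.map u g.1).comp (μ G i j).hom.toLinearMap) := by
  have h1 : rnorm ((hRep (J G i) M).ρ) u = ∑ h : G, ((hRep (J G i) M).ρ h) u := by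
    exact LinearMap.sum_apply _ _ _
  have h2 : rnorm ((hRep (J G (i + j)) (M ⊗ N)).ρ) ((TensorProduct.map u g.1).comp (μ G i j).hom.toLinearMap)
      = ∑ h : G, ((hRep (J G (i + j)) (M ⊗ N)).ρ h)
          ((TensorProduct.map u g.1).comp (μ G i j).hom.toLinearMap) := by
    exact LinearMap.sum_apply _ _ _
  rw [h1, h2]
  refine (map_comp_sum_left (fun h => ((hRep (J G i) M).ρ h) u) g.1 (μ G i j).hom.toLinearMap).trans ?_
  refine Finset.sum_congr rfl fun h _ => ?_
  have hginv : N.ρ h ∘ₗ g.1 ∘ₗ (J G j).ρ h⁻¹ = g.1 := g.2 h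
  refine Eq.trans ?_ (conj_term u g.1 h)
  exact congrArg (fun w : (J G j).V →ₗ[ℤ] N.V =>
    (TensorProduct.map (M.ρ h ∘ₗ u ∘ₗ (J G i).ρ h⁻¹) w).comp (μ G i j).hom.toLinearMap) hginv.symm

lemma cup_norm_right {i j : ℤ} {M N : Rep ℤ G}
    (f : ((hRep (J G i) M).ρ.invariants)) (w : (J G j).V →ₗ[ℤ] N.V) :
    (TensorProduct.map f.1 (rnorm ((hRep (J G j) N).ρ) w)).comp (μ G i j).hom.toLinearMap
      = rnorm ((hRep (J G (i + j)) (M ⊗ N)).ρ)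
          ((TensorProduct.map f.1 w).comp (μ G i j).hom.toLinearMap) := by
  have h1 : rnorm ((hRep (J G j) N).ρ) w = ∑ h : G, ((hRep (J G j) N).ρ h) w := by
    exact LinearMap.sum_apply _ _ _
  have h2 : rnorm ((hRep (J G (i + j)) (M ⊗ N)).ρ) ((TensorProduct.map f.1 w).comp (μ G i j).hom.toLinearMap)
      = ∑ h : G, ((hRep (J G (i + j)) (M ⊗ N)).ρ h)
          ((TensorProduct.map f.1 w).comp (μ G i j).hom.toLinearMap) := by
    exact LinearMap.sum_apply _ _ _
  rw [h1, h2]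
  refine (map_comp_sum_right f.1 (fun h => ((hRep (J G j) N).ρ h) w) (μ G i j).hom.toLinearMap).trans ?_
  refine Finset.sum_congr rfl fun h _ => ?_
  have hfinv : M.ρ h ∘ₗ f.1 ∘ₗ (J G i).ρ h⁻¹ = f.1 := f.2 h
  refine Eq.trans ?_ (conj_term f.1 w h)
  exact congrArg (fun u : (J G i).V →ₗ[ℤ] M.V =>
    (TensorProduct.map u (N.ρ h ∘ₗ w ∘ₗ (J G j).ρ h⁻¹)).comp (μ G i j).hom.toLinearMap) hfinv.symm

lemma cup_welldef {i j : ℤ} {M N : Rep ℤ G}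
    (a₁ : ((hRep (J G i) M).ρ.invariants)) (b₁ : ((hRep (J G j) N).ρ.invariants))
    (a₂ : ((hRep (J G i) M).ρ.invariants)) (b₂ : ((hRep (J G j) N).ρ.invariants))
    (ha : a₁ - a₂ ∈ rnormIm ((hRep (J G i) M).ρ))
    (hb : b₁ - b₂ ∈ rnormIm ((hRep (J G j) N).ρ)) :
    tate0mk (ρ := (hRep (J G (i + j)) (M ⊗ N)).ρ) ((TensorProduct.map a₁.1 b₁.1).comp ((μ G i j).hom.toLinearMap)) (cup_invariance a₁ b₁)
      = tate0mk (ρ := (hRep (J G (i + j)) (M ⊗ N)).ρ) ((TensorProduct.map a₂.1 b₂.1).comp ((μ G i j).hom.toLinearMap)) (cup_invariance a₂ b₂) := by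
  obtain ⟨u, hu⟩ := ha
  obtain ⟨w, hw⟩ := hb
  have hu' : rnorm ((hRep (J G i) M).ρ) u = a₁.1 - a₂.1 := congrArg Subtype.val hu
  have hw' : rnorm ((hRep (J G j) N).ρ) w = b₁.1 - b₂.1 := congrArg Subtype.val hw
  have step1 : tate0mk (ρ := (hRep (J G (i + j)) (M ⊗ N)).ρ) ((TensorProduct.map a₁.1 b₁.1).comp ((μ G i j).hom.toLinearMap))
        (cup_invariance a₁ b₁)
      = tate0mk (ρ := (hRep (J G (i + j)) (M ⊗ N)).ρ) ((TensorProduct.map a₂.1 b₁.1).comp ((μ G i j).hom.toLinearMap)) (cup_invariance a₂ b₁) := by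
    refine (Submodule.Quotient.eq (rnormIm (hRep (J G (i + j)) (M ⊗ N)).ρ)).mpr ?_
    refine ⟨(TensorProduct.map u b₁.1).comp ((μ G i j).hom.toLinearMap), ?_⟩
    apply Subtype.ext
    refine (cup_norm_left u b₁).symm.trans ?_
    refine (congrArg (fun v : (J G i).V →ₗ[ℤ] M.V =>
      (TensorProduct.map v b₁.1).comp (μ G i j).hom.toLinearMap) hu').trans ?_
    exact map_comp_sub_left a₁.1 a₂.1 b₁.1 (μ G i j).hom.toLinearMap
  have step2 : tate0mk (ρ := (hRep (J G (i + j)) (M ⊗ N)).ρ) ((TensorProduct.map a₂.1 b₁.1).comp ((μ G i j).hom.toLinearMap))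
        (cup_invariance a₂ b₁)
      = tate0mk (ρ := (hRep (J G (i + j)) (M ⊗ N)).ρ) ((TensorProduct.map a₂.1 b₂.1).comp ((μ G i j).hom.toLinearMap)) (cup_invariance a₂ b₂) := by
    refine (Submodule.Quotient.eq (rnormIm (hRep (J G (i + j)) (M ⊗ N)).ρ)).mpr ?_
    refine ⟨(TensorProduct.map a₂.1 w).comp ((μ G i j).hom.toLinearMap), ?_⟩
    apply Subtype.ext
    refine (cup_norm_right a₂ w).symm.trans ?_
    refine (congrArg (fun v : (J G j).V →ₗ[ℤ] N.V =>
      (TensorProduct.map a₂.1 v).comp (μ G i j).hom.toLinearMap) hw').trans ?_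
    exact map_comp_sub_right a₂.1 b₁.1 b₂.1 (μ G i j).hom.toLinearMap
  exact step1.trans step2

/-- The cup product `Ĥ^i(G, M) × Ĥ^j(G, N) → Ĥ^{i+j}(G, M ⊗ N)` on Tate cohomology,
induced by the comparison maps `μ`. -/
noncomputable def cup {i j : ℤ} {M N : Rep ℤ G} (z₁ : tate i M) (z₂ : tate j N) :
    tate (i + j) (M ⊗ N) :=
  Quotient.liftOn₂ z₁ z₂
    (fun f g => tate0mk ((TensorProduct.map f.1 g.1).comp ((μ G i j).hom.toLinearMap)) (cup_invariance f g))
    (fun a₁ b₁ a₂ b₂ ha hb => cup_welldef a₁ b₁ a₂ b₂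
      ((Submodule.quotientRel_def _).mp ha) ((Submodule.quotientRel_def _).mp hb))

/-! ### Pairings -/

/-- The composition pairing `Hom_ℤ(B, C) ⊗ Hom_ℤ(A, B) ⟶ Hom_ℤ(A, C)`, `f ⊗ φ ↦ f ∘ φ`. -/
noncomputable def compPair (A B C : Rep ℤ G) : hRep B C ⊗ hRep A B ⟶ hRep A C :=
  MonoidalClosed.curry <|
    (A ◁ (β_ (hRep B C) (hRep A B)).hom) ≫ (α_ A (hRep A B) (hRep B C)).inv
      ≫ (((ihom.ev A).app B) ▷ hRep B C) ≫ (ihom.ev B).app C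

/-- The evaluation pairing `Hom_ℤ(X, B) ⊗ X ⟶ B`, `f ⊗ x ↦ f x`. -/
noncomputable def evPair (X B : Rep ℤ G) : hRep X B ⊗ X ⟶ B :=
  (β_ (hRep X B) X).hom ≫ (ihom.ev X).app B

/-- The cup product `Ĥ^i(G, Hom(X, A)) × Ĥ^j(G, Hom(X', X)) → Ĥ^{i+j}(G, Hom(X', A))`
induced by the composition pairing. -/
noncomputable def ccup {i j : ℤ} {X X' A : Rep ℤ G}
    (z : tate i (hRep X A)) (x : tate j (hRep X' X)) : tate (i + j) (hRep X' A) :=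
  tmap (i + j) (compPair X' X A) (cup z x)

/-- `ccup`, with the degree of the target adjusted along an equality of integers. -/
noncomputable def ccupTo {i j m : ℤ} {X X' A : Rep ℤ G}
    (z : tate i (hRep X A)) (x : tate j (hRep X' X)) (h : i + j = m) :
    tate m (hRep X' A) :=
  tcast h (ccup z x)

/-- The class of the identity in `Ĥ⁰(G, Hom_ℤ(X, X))`. -/
noncomputable def idCls (X : Rep ℤ G) : tate 0 (hRep X X) :=
  mkCls (MonoidalClosed.curry (ρ_ X).hom)

/-! ### Encoding pairs and related notions -/

/-- `(X, X')` is an *`r`-encoding pair* if for some `i ∈ ℤ` there is a natural isomorphism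
of functors `Ĥ^i(G, Hom_ℤ(X, -)) ≅ Ĥ^{i+r}(G, Hom_ℤ(X', -))` on `Rep ℤ G`. -/
def IsEncodingPair {G : Type} [Group G] [Fintype G] (r : ℤ) (X X' : Rep ℤ G) : Prop :=
  ∃ (i : ℤ) (e : ∀ A : Rep ℤ G, tate i (hRep X A) ≃+ tate (i + r) (hRep X' A)),
    ∀ {A B : Rep ℤ G} (φ : A ⟶ B) (z : tate i (hRep X A)),
      e B (tmap i ((Rep.ihom X).map φ) z) = tmap (i + r) ((Rep.ihom X').map φ) (e A z)

/-- `x ∈ Ĥ^r(G, Hom_ℤ(X', X))` is an *encoding element* for the pair `(X, X')` if it has a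
*decoding element* `x' ∈ Ĥ^{-r}(G, Hom_ℤ(X, X'))` with `x' ∪ x = [id_{X'}]` and
`x ∪ x' = [id_X]`. -/
def IsEncodingElement {G : Type} [Group G] [Fintype G] {r : ℤ} (X X' : Rep ℤ G)
    (x : tate r (hRep X' X)) : Prop :=
  ∃ x' : tate (-r) (hRep X X'),
    ccupTo x' x (by ring) = idCls X' ∧ ccupTo x x' (by ring) = idCls X

/-- The induced `G`-module `ℤ[G] ⊗_ℤ A ≅ (G →₀ A)`, with `G` acting by left translation. -/
noncomputable def indRep (G : Type) [Group G] (A : Type) [AddCommGroup A] [Module ℤ A] :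
    Rep ℤ G :=
  Rep.of (G := G) (X := G →₀ A)
    { toFun := fun g => Finsupp.lmapDomain A ℤ (fun h => g * h)
      map_one' := by
        ext x h
        simp [Finsupp.lmapDomain_apply, Finsupp.mapDomain_id, one_mul]
      map_mul' := fun g g' => by
        ext x h
        simp [Finsupp.lmapDomain_apply, Module.End.mul_apply, Finsupp.mapDomain_single,
          mul_assoc] }

/-- A `G`-module is *induced* if it is isomorphic to `ℤ[G] ⊗_ℤ A` for some abelian group `A`. -/
def IsInduced {G : Type} [Group G] (M : Rep ℤ G) : Prop :=
  ∃ (A : Type) (_ : AddCommGroup A) (_ : Module ℤ A), Nonempty (M ≅ indRep G A)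

/-- A class `φ ∈ Ĥ⁰(G, Hom_ℤ(X, X))` is a unit for the (composition) cup product. -/
def IsUnitCls {G : Type} [Group G] [Fintype G] {X : Rep ℤ G}
    (φ : tate 0 (hRep X X)) : Prop :=
  ∃ ψ : tate 0 (hRep X X),
    ccupTo φ ψ (by ring) = idCls X ∧ ccupTo ψ φ (by ring) = idCls X


/-- The natural map `Hom_ℤ(X, A) ⊗ I_G ⟶ Hom_ℤ(X, A ⊗ I_G)`, `f ⊗ z ↦ (x ↦ f x ⊗ z)`. -/
noncomputable def pr0 (X A : Rep ℤ G) : hRep X A ⊗ IGrep G ⟶ hRep X (A ⊗ IGrep G) :=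
  MonoidalClosed.curry ((α_ X (hRep X A) (IGrep G)).inv ≫ ((ihom.ev X).app A ▷ IGrep G))

/-- The natural evaluation map `Hom_ℤ(X, Hom_ℤ(I_G, A)) ⊗ I_G ⟶ Hom_ℤ(X, A)`,
`f ⊗ z ↦ (x ↦ f x z)`. -/
noncomputable def pr1 (X A : Rep ℤ G) :
    hRep X (hRep (IGrep G) A) ⊗ IGrep G ⟶ hRep X A :=
  MonoidalClosed.curry ((α_ X (hRep X (hRep (IGrep G) A)) (IGrep G)).inv
    ≫ ((ihom.ev X).app (hRep (IGrep G) A) ▷ IGrep G) ≫ evPair (IGrep G) A)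

/-- The natural evaluation map `Hom_ℤ(X', X) ⊗ (X' ⊗ A) ⟶ X ⊗ A`. -/
noncomputable def tPair (X' X A : Rep ℤ G) : hRep X' X ⊗ (X' ⊗ A) ⟶ X ⊗ A :=
  (α_ (hRep X' X) X' A).inv ≫ (evPair X' X ▷ A)

/-- A functor `Rep ℤ G ⥤ Rep ℤ G` sends `ℤ`-split short exact sequences of `G`-modules to
short exact sequences of `G`-modules. -/
def PreservesZSplitSES {G : Type} [Group G] (F : Rep.{0} ℤ G ⥤ Rep.{0} ℤ G) : Prop :=
  ∀ (A B C : Rep.{0} ℤ G) (f : A ⟶ B) (g : B ⟶ C),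
    Function.Injective f.hom → Function.Surjective g.hom → Function.Exact f.hom g.hom →
    (∃ s : C.V →+ B.V, ∀ x, g.hom (s x) = x) →
    Function.Injective (F.map f).hom ∧ Function.Surjective (F.map g).hom ∧
      Function.Exact (F.map f).hom (F.map g).hom

/-- A *shiftable functor*: it sends `ℤ`-split short exact sequences of `G`-modules to short
exact sequences, and sends induced modules to induced modules. -/
def Shiftable {G : Type} [Group G] (F : Rep.{0} ℤ G ⥤ Rep.{0} ℤ G) : Prop :=
  PreservesZSplitSES F ∧ ∀ M : Rep ℤ G, IsInduced M → IsInduced (F.obj M)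

end Enc

open CategoryTheory MonoidalCategory Enc

namespace S13

variable {R : Type} [CommRing R] {G : Type} [Group G] [Fintype G]

/-- Relative projectivity: the identity is a norm. -/
def RelProj {V : Type} [AddCommGroup V] [Module R V] (ρ : Representation R G V) : Prop :=
  ∃ φ : V →ₗ[R] V, ∀ v, ∑ g : G, ρ g (φ (ρ g⁻¹ v)) = v

lemma single_one_smul {V : Type} [AddCommGroup V] [Module R V] (ρ : Representation R G V)
    (g : G) (v : ρ.asModule) : MonoidAlgebra.single g (1 : R) • v =
      ρ.asModuleEquiv.symm (ρ g (ρ.asModuleEquiv v)) :=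
  (Representation.single_smul ρ 1 g v).trans (one_smul _ _)

lemma RelProj.projective {V : Type} [AddCommGroup V] [Module R V] (ρ : Representation R G V)
    [Module.Free R V] (h : RelProj ρ) : Module.Projective (MonoidAlgebra R G) ρ.asModule := by
  obtain ⟨φ, hφ⟩ := h
  let p : (ρ.asModule →₀ MonoidAlgebra R G) →ₗ[MonoidAlgebra R G] ρ.asModule :=
    Finsupp.linearCombination (MonoidAlgebra R G) id
  have hp : Function.Surjective p :=
    Finsupp.linearCombination_surjective _ Function.surjective_id
  have hproj : Module.Projective R ρ.asModule :=
    Module.Projective.of_equiv ρ.asModuleEquiv.symm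
  obtain ⟨s, hs⟩ := Module.projective_lifting_property (p.restrictScalars R) LinearMap.id hp
  let φ' : ρ.asModule →ₗ[R] ρ.asModule :=
    ρ.asModuleEquiv.symm.toLinearMap ∘ₗ φ ∘ₗ ρ.asModuleEquiv.toLinearMap
  let S := (s ∘ₗ φ').sumOfConjugatesEquivariant G
  refine Module.Projective.of_split S p ?_
  ext v
  have hs' : ∀ x, p (s x) = x := fun x => LinearMap.congr_fun hs x
  simp only [LinearMap.comp_apply, LinearMap.id_apply, S,
    LinearMap.sumOfConjugatesEquivariant_apply, map_sum, LinearMap.conjugate_apply, map_smul, hs',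
    single_one_smul]
  rw [← Equiv.sum_comp (Equiv.inv G)]
  simp only [Equiv.inv_apply, inv_inv]
  exact hφ (ρ.asModuleEquiv v)

lemma relProj_of_projective {V : Type} [AddCommGroup V] [Module R V] (ρ : Representation R G V)
    (h : Module.Projective (MonoidAlgebra R G) ρ.asModule) : RelProj ρ := by
  obtain ⟨s, hs⟩ := Module.projective_def'.1 h
  let p : (ρ.asModule →₀ MonoidAlgebra R G) →ₗ[MonoidAlgebra R G] ρ.asModule :=
    Finsupp.linearCombination (MonoidAlgebra R G) id
  have hs' : ∀ x, p (s x) = x := fun x => LinearMap.congr_fun hs x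
  let c : MonoidAlgebra R G →ₗ[R] MonoidAlgebra R G :=
    { toFun := fun a => MonoidAlgebra.single 1 (a.coeff 1)
      map_add' := by intro a b; simp
      map_smul' := by intro a b; simp }
  have hc : ∀ a : MonoidAlgebra R G, ∑ g : G, MonoidAlgebra.single g (1:R) *
      c (MonoidAlgebra.single g⁻¹ (1:R) * a) = a := by
    intro a
    have hc0 : ∀ a : MonoidAlgebra R G, c a = MonoidAlgebra.single 1 (a.coeff 1) := fun _ => rfl
    simp only [hc0]
    ext h
    simp [MonoidAlgebra.single_mul_single]
  let cF : (ρ.asModule →₀ MonoidAlgebra R G) →ₗ[R] (ρ.asModule →₀ MonoidAlgebra R G) :=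
    Finsupp.mapRange.linearMap c
  have hcF : ∀ f, ∑ g : G, MonoidAlgebra.single g (1:R) •
      cF (MonoidAlgebra.single g⁻¹ (1:R) • f) = f := by
    intro f
    refine Finsupp.ext fun x => ?_
    rw [Finsupp.finsetSum_apply]
    exact hc (f x)
  let φ : V →ₗ[R] V := ρ.asModuleEquiv.toLinearMap ∘ₗ (p.restrictScalars R) ∘ₗ cF ∘ₗ
    (s.restrictScalars R) ∘ₗ ρ.asModuleEquiv.symm.toLinearMap
  refine ⟨φ, fun v => ?_⟩
  have h1 := congrArg p (hcF (s (ρ.asModuleEquiv.symm v)))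
  rw [hs', map_sum] at h1
  simp only [map_smul] at h1
  simp only [← map_smul s, single_one_smul] at h1
  exact h1

section trace
variable {J X : Type} [AddCommGroup J] [Module R J] [AddCommGroup X] [Module R X]

lemma bilin_trace {κ : Type} [Fintype κ] (b : Module.Basis κ R J)
    (B : Module.Dual R J →ₗ[R] J →ₗ[R] X) (a a' : J →ₗ[R] J) (h : ∀ j, a' (a j) = j) :
    ∑ k, B (b.coord k ∘ₗ a) (a' (b k)) = ∑ k, B (b.coord k) (b k) := by
  have h1 : ∀ k, B (b.coord k ∘ₗ a) (a' (b k))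
      = ∑ l, b.coord k (a (b l)) • B (b.coord l) (a' (b k)) := by
    intro k
    conv_lhs => rw [← b.sum_dual_apply_smul_coord (b.coord k ∘ₗ a)]
    simp only [map_sum, LinearMap.sum_apply, map_smul, LinearMap.smul_apply, LinearMap.comp_apply]
  rw [Finset.sum_congr rfl fun k _ => h1 k, Finset.sum_comm]
  refine Finset.sum_congr rfl fun l _ => ?_
  simp only [← map_smul]
  rw [← map_sum, ← map_sum]
  have h2 : ∑ k, b.coord k (a (b l)) • b k = a (b l) := b.sum_repr (a (b l))
  rw [h2, h]

/-- The pairing `(f, j) ↦ (f ⊗ id) (T j)`. -/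
noncomputable def pairT (T : J →ₗ[R] J ⊗[R] X) : Module.Dual R J →ₗ[R] J →ₗ[R] X where
  toFun f := (TensorProduct.lid R X).toLinearMap ∘ₗ LinearMap.rTensor X f ∘ₗ T
  map_add' f g := by
    refine LinearMap.ext fun x => ?_
    simp [LinearMap.rTensor_add]
  map_smul' f g := by
    refine LinearMap.ext fun x => ?_
    simp [LinearMap.rTensor_smul]

lemma pairT_apply (T : J →ₗ[R] J ⊗[R] X) (f : Module.Dual R J) (j : J) :
    pairT T f j = TensorProduct.lid R X (LinearMap.rTensor X f (T j)) := rfl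

lemma lid_map (f : Module.Dual R J) (a : J →ₗ[R] J) (w : X →ₗ[R] X) (y : J ⊗[R] X) :
    TensorProduct.lid R X (LinearMap.rTensor X f (TensorProduct.map a w y))
      = w (TensorProduct.lid R X (LinearMap.rTensor X (f ∘ₗ a) y)) := by
  induction y with
  | zero => simp only [map_zero]
  | add y z hy hz => simp only [map_add, hy, hz]
  | tmul j x => simp

/-- Partial trace. -/
noncomputable def ptr {κ : Type} [Fintype κ] (b : Module.Basis κ R J)
    (u : J →ₗ[R] X →ₗ[R] J ⊗[R] X) : X →ₗ[R] X :=
  ∑ k, (TensorProduct.lid R X).toLinearMap ∘ₗ LinearMap.rTensor X (b.coord k) ∘ₗ u (b k)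

lemma ptr_apply {κ : Type} [Fintype κ] (b : Module.Basis κ R J)
    (u : J →ₗ[R] X →ₗ[R] J ⊗[R] X) (x : X) :
    ptr b u x = ∑ k, pairT (u.flip x) (b.coord k) (b k) := by
  simp [ptr, pairT_apply, LinearMap.sum_apply]

lemma ptr_norm {κ : Type} [Fintype κ] (b : Module.Basis κ R J)
    (ρJ : Representation R G J) (ρX : Representation R G X)
    (u : J →ₗ[R] X →ₗ[R] J ⊗[R] X)
    (hu : ∀ j x, ∑ g : G, TensorProduct.map (ρJ g) (ρX g) (u (ρJ g⁻¹ j) (ρX g⁻¹ x)) = j ⊗ₜ x)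
    (x : X) : ∑ g : G, ρX g (ptr b u (ρX g⁻¹ x)) = (Fintype.card κ : R) • x := by
  have h1 : ∀ g : G, ρX g (ptr b u (ρX g⁻¹ x)) = ∑ k, TensorProduct.lid R X
      (LinearMap.rTensor X (b.coord k)
        (TensorProduct.map (ρJ g) (ρX g) (u (ρJ g⁻¹ (b k)) (ρX g⁻¹ x)))) := by
    intro g
    rw [ptr_apply, ← bilin_trace b _ (ρJ g) (ρJ g⁻¹) (fun j => Representation.inv_self_apply ρJ g j),
      map_sum]
    refine Finset.sum_congr rfl fun k _ => ?_
    rw [lid_map]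
    rfl
  rw [Finset.sum_congr rfl fun g _ => h1 g, Finset.sum_comm]
  have h2 : ∀ k, ∑ g : G, TensorProduct.lid R X
      (LinearMap.rTensor X (b.coord k)
        (TensorProduct.map (ρJ g) (ρX g) (u (ρJ g⁻¹ (b k)) (ρX g⁻¹ x)))) = x := by
    intro k
    rw [← map_sum, ← map_sum, hu]
    simp
  rw [Finset.sum_congr rfl fun k _ => h2 k, Finset.sum_const, Finset.card_univ,
    Nat.cast_smul_eq_nsmul]

lemma relProj_of_coprime [Nontrivial R] [Module.Free R J] [Module.Finite R J]
    (ρJ : Representation R G J) (ρX : Representation R G X)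
    (hc : IsCoprime (Module.finrank R J : R) (Fintype.card G : R))
    (u : J →ₗ[R] X →ₗ[R] J ⊗[R] X)
    (hu : ∀ j x, ∑ g : G, TensorProduct.map (ρJ g) (ρX g) (u (ρJ g⁻¹ j) (ρX g⁻¹ x)) = j ⊗ₜ x) :
    RelProj ρX := by
  obtain ⟨s, t, hst⟩ := hc
  let b := Module.finBasis R J
  refine ⟨s • ptr b u + t • LinearMap.id, fun x => ?_⟩
  have h1 := ptr_norm b ρJ ρX u hu x
  simp only [LinearMap.add_apply, LinearMap.smul_apply, map_add, map_smul, LinearMap.id_apply,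
    Representation.self_inv_apply, Finset.sum_add_distrib, ← Finset.smul_sum, h1]
  simp only [Finset.sum_const, Finset.card_univ, Fintype.card_fin]
  rw [← Nat.cast_smul_eq_nsmul R, smul_smul, smul_smul, ← add_smul, hst, one_smul]

end trace

section ranks
variable (G)

lemma finrank_ker_add_one {R M : Type} [CommRing R] [IsDomain R] [AddCommGroup M] [Module R M]
    [Module.Finite R M] (f : M →ₗ[R] R) (hf : Function.Surjective f) :
    Module.finrank R (LinearMap.ker f) + 1 = Module.finrank R M := by
  rw [← (LinearMap.ker f).finrank_quotient_add_finrank,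
    (f.quotKerEquivOfSurjective hf).finrank_eq, Module.finrank_self, add_comm]

lemma finrank_IG : (Module.finrank ℤ (IGcar G) : ℤ) = Fintype.card G - 1 := by
  have hs : Function.Surjective (aug G) := by
    intro n
    refine ⟨Finsupp.single 1 n, ?_⟩
    simp [aug]
  have hfin : Module.Finite ℤ (G →₀ ℤ) :=
    Module.Finite.equiv (Finsupp.linearEquivFunOnFinite ℤ ℤ G).symm
  have h := finrank_ker_add_one (aug G) hs
  rw [Module.finrank_finsupp_self] at h
  exact eq_sub_of_add_eq (by exact_mod_cast h)

lemma coprime_IG : IsCoprime (Module.finrank ℤ (IGcar G) : ℤ) (Fintype.card G : ℤ) := by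
  rw [finrank_IG]
  exact ⟨-1, 1, by ring⟩

/-- Finite free with rank coprime to `|G|`. -/
def Good {R : Type} [CommRing R] (M : Rep.{0} R G) : Prop :=
  Module.Free R M.V ∧ Module.Finite R M.V ∧
    IsCoprime (Module.finrank R M.V : R) (Fintype.card G : R)

lemma good_IG : Good G (IGrep G) :=
  ⟨inferInstanceAs (Module.Free ℤ (IGcar G)), inferInstanceAs (Module.Finite ℤ (IGcar G)),
    coprime_IG G⟩

lemma finrank_dual' {R M : Type} [CommRing R] [Nontrivial R] [AddCommGroup M] [Module R M]
    [Module.Finite R M] [Module.Free R M] :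
    Module.finrank R (Module.Dual R M) = Module.finrank R M := by
  show Module.finrank R (M →ₗ[R] R) = _
  rw [Module.finrank_linearMap, Module.finrank_self, mul_one]

lemma good_DIG : Good G (DIG G) := by
  refine ⟨inferInstanceAs (Module.Free ℤ (Module.Dual ℤ (IGcar G))),
    inferInstanceAs (Module.Finite ℤ (Module.Dual ℤ (IGcar G))), ?_⟩
  have : Module.finrank ℤ (Module.Dual ℤ (IGcar G)) = Module.finrank ℤ (IGcar G) :=
    finrank_dual' 
  have h2 := coprime_IG G
  rw [← this] at h2
  exact h2

lemma good_one : Good G (𝟙_ (Rep.{0} ℤ G)) := by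
  refine ⟨inferInstanceAs (Module.Free ℤ ℤ), inferInstanceAs (Module.Finite ℤ ℤ), ?_⟩
  have : IsCoprime (Module.finrank ℤ ℤ : ℤ) (Fintype.card G : ℤ) := by
    simp [isCoprime_one_left]
  exact this

lemma good_tensor {R : Type} [CommRing R] [Nontrivial R] {M N : Rep.{0} R G} (hM : Good G M) (hN : Good G N) : Good G (M ⊗ N) := by
  obtain ⟨h1, h2, h3⟩ := hM
  obtain ⟨h4, h5, h6⟩ := hN
  refine ⟨inferInstanceAs (Module.Free R (M.V ⊗[R] N.V)),
    inferInstanceAs (Module.Finite R (M.V ⊗[R] N.V)), ?_⟩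
  have : IsCoprime (Module.finrank R (M.V ⊗[R] N.V) : R) (Fintype.card G : R) := by
    rw [Module.finrank_tensorProduct]
    push_cast
    exact h3.mul_left h6
  exact this

lemma good_Jp (n : ℕ) : Good G (Jp G n) := by
  induction n with
  | zero => exact good_one G
  | succ n ih => exact good_tensor G ih (good_IG G)

lemma good_Jn (n : ℕ) : Good G (Jn G n) := by
  induction n with
  | zero => exact good_one G
  | succ n ih => exact good_tensor G ih (good_DIG G)

lemma good_J (i : ℤ) : Good G (J G i) := by
  cases i with
  | ofNat n => exact good_Jp G n
  | negSucc n => exact good_Jn G (n + 1)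

end ranks

lemma relProj_of_subsingleton [Nontrivial R] (X : Rep.{0} R G) (Jm : Rep.{0} R G)
    (hJ : Good G Jm) (h : Subsingleton (H0T ((Rep.ihom Jm).obj ((Rep.ihom X).obj (Jm ⊗ X))))) : RelProj X.ρ := by
  obtain ⟨h1, h2, h3⟩ := hJ
  let f : Jm.V →ₗ[R] X.V →ₗ[R] Jm.V ⊗[R] X.V := TensorProduct.mk R _ _
  have hf : f ∈ ((Rep.ihom Jm).obj ((Rep.ihom X).obj (Jm ⊗ X))).ρ.invariants := by
    intro g
    refine LinearMap.ext fun j => LinearMap.ext fun x => ?_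
    show TensorProduct.map (Jm.ρ g) (X.ρ g) ((Jm.ρ g⁻¹ j) ⊗ₜ (X.ρ g⁻¹ x)) = j ⊗ₜ x
    rw [TensorProduct.map_tmul, Representation.self_inv_apply, Representation.self_inv_apply]
  have h0 : tate0mk (ρ := ((Rep.ihom Jm).obj ((Rep.ihom X).obj (Jm ⊗ X))).ρ) f hf = 0 :=
    @Subsingleton.elim _ h _ _
  obtain ⟨u, hu⟩ := (Submodule.Quotient.mk_eq_zero _).1 h0
  have hu' : rnorm ((Rep.ihom Jm).obj ((Rep.ihom X).obj (Jm ⊗ X))).ρ u = f := congrArg Subtype.val hu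
  refine relProj_of_coprime Jm.ρ X.ρ h3 u fun j x => ?_
  have h4 : (∑ g : G, ((Rep.ihom Jm).obj ((Rep.ihom X).obj (Jm ⊗ X))).ρ g u) = f :=
    (LinearMap.sum_apply _ _ _).symm.trans hu'
  have h5 := congrArg (fun F : Jm.V →ₗ[R] X.V →ₗ[R] Jm.V ⊗[R] X.V => F j x) h4
  refine Eq.trans ?_ h5
  have h6 : ∀ (F : G → (Jm.V →ₗ[R] X.V →ₗ[R] Jm.V ⊗[R] X.V)),
      (∑ g : G, F g) j x = ∑ g : G, F g j x := by
    intro F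
    simp only [LinearMap.sum_apply]
  exact (h6 (fun g => ((Rep.ihom Jm).obj ((Rep.ihom X).obj (Jm ⊗ X))).ρ g u)).symm

lemma subsingleton_of_relProj (X A : Rep.{0} R G) (Jm : Rep.{0} R G) (h : RelProj X.ρ) :
    Subsingleton (H0T ((Rep.ihom Jm).obj ((Rep.ihom X).obj A))) := by
  obtain ⟨φ, hφ⟩ := h
  suffices H : ∀ z : H0T ((Rep.ihom Jm).obj ((Rep.ihom X).obj A)), z = 0 from ⟨fun a b => (H a).trans (H b).symm⟩
  intro z
  obtain ⟨⟨f, hf⟩, rfl⟩ := Submodule.Quotient.mk_surjective _ z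
  refine (Submodule.Quotient.mk_eq_zero _).2 ?_
  let f' : Jm.V →ₗ[R] X.V →ₗ[R] A.V := f
  let u : Jm.V →ₗ[R] X.V →ₗ[R] A.V := (LinearMap.lcomp R A.V φ) ∘ₗ f'
  refine ⟨u, Subtype.ext ?_⟩
  refine (LinearMap.sum_apply _ _ _).trans ?_
  show _ = f'
  refine LinearMap.ext fun j => LinearMap.ext fun x => ?_
  have h6 : ∀ (F : G → (Jm.V →ₗ[R] X.V →ₗ[R] A.V)),
      (∑ g : G, F g) j x = ∑ g : G, F g j x := by
    intro F
    simp only [LinearMap.sum_apply]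
  refine (h6 _).trans ?_
  have hinv : ∀ g : G, ∀ y : X.V, A.ρ g (f' (Jm.ρ g⁻¹ j) y) = f' j (X.ρ g y) := by
    intro g y
    have h7 := congrArg (fun F : Jm.V →ₗ[R] X.V →ₗ[R] A.V => F j (X.ρ g y)) (hf g)
    have h8 : A.ρ g (f' (Jm.ρ g⁻¹ j) (X.ρ g⁻¹ (X.ρ g y))) = f' j (X.ρ g y) := h7
    rwa [Representation.inv_self_apply] at h8
  have h9 : ∑ g : G, A.ρ g (f' (Jm.ρ g⁻¹ j) (φ (X.ρ g⁻¹ x))) = f' j x := by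
    rw [Finset.sum_congr rfl fun g _ => hinv g _, ← map_sum, hφ]
  exact h9

open ZeroObject in
lemma relProj_zero : RelProj (0 : Rep.{0} R G).ρ := by
  have hz : ∀ v : (0 : Rep.{0} R G).V, v = 0 := by
    intro v
    have h : 𝟙 (0 : Rep.{0} R G) = 0 := Limits.IsZero.eq_of_src (Limits.isZero_zero _) _ _
    exact congrArg (fun f : (0 : Rep.{0} R G) ⟶ 0 => f.hom v) h
  exact ⟨0, fun v => (hz _).trans (hz v).symm⟩

end S13

open ZeroObject in
theorem statement13 (G : Type) [Group G] [Fintype G] (X : Rep ℤ G)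
    (hX : Module.Free ℤ X.V) :
    IsEncodingPair 0 X 0 ↔ Module.Projective (MonoidAlgebra ℤ G) X.ρ.asModule := by
  constructor
  · rintro ⟨i, e, -⟩
    have hs := S13.subsingleton_of_relProj 0 (J G i ⊗ X) (J G (i + 0)) (S13.relProj_zero (R := ℤ) (G := G))
    exact (S13.relProj_of_subsingleton X (J G i) (S13.good_J G i) (@Equiv.subsingleton _ _ (e (J G i ⊗ X)).toEquiv hs)).projective
  · intro h
    have hr := S13.relProj_of_projective X.ρ h
    have s1 := fun A => S13.subsingleton_of_relProj X A (J G 0) hr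
    have s2 := fun A => S13.subsingleton_of_relProj 0 A (J G (0 + 0)) (S13.relProj_zero (R := ℤ) (G := G))
    refine ⟨0, fun A => ?_, fun φ z => (s2 _).elim _ _⟩
    exact { toFun := fun _ => 0, invFun := fun _ => 0, left_inv := fun _ => (s1 A).elim _ _,
            right_inv := fun _ => (s2 A).elim _ _, map_add' := fun _ _ => (s2 A).elim _ _ }
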